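/- arXiv:1812.05261 — 2 statements merged into one kernel-verified Lean document; each statement's English description precedes it below -/
import Mathlib

section
/- Let K be a field. For each λ ∈ K, the representation M(λ) of the cube poset {0,1}³ is thin and indecomposable. -/
open Classical

structure PRep (K : Type) [Field K] (P : Type) [PartialOrder P] : Type 1 where
  V : P → Type
  [isAddCommGroup : ∀ x, AddCommGroup (V x)]
  [isModule : ∀ x, Module K (V x)]
  [isFinite : ∀ x, Module.Finite K (V x)]
  map : ∀ {x y : P}, x ≤ y → (V x →ₗ[K] V y)
  map_refl : ∀ x : P, map (le_refl x) = LinearMap.id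
  map_trans : ∀ {x y z : P} (hxy : x ≤ y) (hyz : y ≤ z),
    map (le_trans hxy hyz) = (map hyz).comp (map hxy)

attribute [instance] PRep.isAddCommGroup PRep.isModule PRep.isFinite

variable {K : Type} [Field K] {P : Type} [PartialOrder P]

namespace PRep

/-- Isomorphism of representations. -/
def Iso (M N : PRep K P) : Prop :=
  ∃ e : ∀ x : P, M.V x ≃ₗ[K] N.V x,
    ∀ (x y : P) (h : x ≤ y),
      (N.map h).comp (e x : M.V x →ₗ[K] N.V x)
        = (e y : M.V y →ₗ[K] N.V y).comp (M.map h)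

/-- Pointwise direct sum of two representations. -/
def dsum (M N : PRep K P) : PRep K P where
  V x := M.V x × N.V x
  map h := (M.map h).prodMap (N.map h)
  map_refl x := by
    apply LinearMap.ext; intro v
    simp [M.map_refl, N.map_refl]
  map_trans hxy hyz := by
    apply LinearMap.ext; intro v
    simp [M.map_trans hxy hyz, N.map_trans hxy hyz]

def IsThin (M : PRep K P) : Prop := ∀ x : P, Module.finrank K (M.V x) ≤ 1

def supp (M : PRep K P) : Set P := {x : P | Nontrivial (M.V x)}

def Indecomposable (M : PRep K P) : Prop :=
  (∃ x : P, Nontrivial (M.V x)) ∧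
  ∀ N₁ N₂ : PRep K P, M.Iso (N₁.dsum N₂) →
    (∀ x : P, Subsingleton (N₁.V x)) ∨ (∀ x : P, Subsingleton (N₂.V x))

end PRep

/-- Convexity of a subset of a poset. -/
def IsConvexSet (I : Set P) : Prop :=
  ∀ ⦃a b c : P⦄, a ∈ I → c ∈ I → a ≤ b → b ≤ c → b ∈ I

/-- Connectedness of a subset of a poset. -/
def IsConnectedSet (I : Set P) : Prop :=
  ∀ a ∈ I, ∀ b ∈ I,
    Relation.ReflTransGen (fun u v : P => u ∈ I ∧ v ∈ I ∧ (u ≤ v ∨ v ≤ u)) a b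

/-- An interval of a poset: nonempty, convex and connected subset. -/
def IsIntervalSet (I : Set P) : Prop :=
  I.Nonempty ∧ IsConvexSet I ∧ IsConnectedSet I

/-- The interval representation associated to a convex subset `I`. -/
noncomputable def intervalRep (K : Type) [Field K] {P : Type} [PartialOrder P]
    (I : Set P) (hI : IsConvexSet I) : PRep K P where
  V x := ↥(if x ∈ I then (⊤ : Submodule K K) else ⊥)
  map {x y} h :=
    { toFun := fun v => ⟨if y ∈ I then (v : K) else 0, by
        by_cases hy : y ∈ I <;>
          simp only [hy, if_true, if_false, Submodule.mem_top, Submodule.zero_mem]⟩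
      map_add' := fun v w => by
        apply Subtype.ext
        by_cases hy : y ∈ I <;> simp [hy]
      map_smul' := fun c v => by
        apply Subtype.ext
        by_cases hy : y ∈ I <;> simp [hy] }
  map_refl x := by
    apply LinearMap.ext; intro v
    apply Subtype.ext
    by_cases hx : x ∈ I
    · simp [hx]
    · have hv0 : (v : K) = 0 := by simpa only [hx, if_false, Submodule.mem_bot] using v.2
      exact (if_neg hx).trans hv0.symm
  map_trans {x y z} hxy hyz := by
    apply LinearMap.ext; intro v
    apply Subtype.ext
    by_cases hz : z ∈ I
    · by_cases hy : y ∈ I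
      · exact (if_pos hz).trans ((if_pos hz).trans (if_pos hy)).symm
      · by_cases hx : x ∈ I
        · exact absurd (hI hx hz hxy hyz) hy
        · have hv0 : (v : K) = 0 := by simpa only [hx, if_false, Submodule.mem_bot] using v.2
          simp [hz, hy, hv0]
    · simp [hz]

namespace PRep

def IsPreInterval (M : PRep K P) : Prop :=
  M.IsThin ∧ IsIntervalSet M.supp ∧
    ∀ (x y : P) (h : x ≤ y), x ∈ M.supp → y ∈ M.supp → M.map h ≠ 0

end PRep

/-- The cube poset `{0,1}³` with the componentwise order. -/
abbrev Cube : Type := Fin 2 × Fin 2 × Fin 2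

def cubeBot : Cube := (0, 0, 0)
def cubeTop : Cube := (1, 1, 1)
def cubeA : Cube := (0, 0, 1)
def cubeB : Cube := (0, 1, 1)

/-- Scalar coefficient of the structure map of `M(λ)` from `x` to `y`:
zero into/out of the two zero vertices, `λ` on the covering relation
`(0,0,1) ≤ (0,1,1)`, and `1` otherwise. -/
noncomputable def cubeCoef {K : Type} [Field K] (lam : K) (x y : Cube) : K :=
  if x = cubeBot ∨ x = cubeTop ∨ y = cubeBot ∨ y = cubeTop then 0
  else if x = cubeA ∧ y = cubeB then lam else 1

lemma cubeCoef_self {K : Type} [Field K] (lam : K) (x : Cube)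
    (hx : ¬(x = cubeBot ∨ x = cubeTop)) : cubeCoef lam x x = 1 := by
  unfold cubeCoef
  rw [if_neg (by tauto), if_neg]
  rintro ⟨h1, h2⟩
  rw [h1] at h2
  exact absurd h2 (by decide)

lemma cubeCoef_zero_right {K : Type} [Field K] (lam : K) (x y : Cube)
    (hy : y = cubeBot ∨ y = cubeTop) : cubeCoef lam x y = 0 := by
  unfold cubeCoef
  rw [if_pos (by tauto)]

lemma cube_le_bot : ∀ x : Cube, x ≤ cubeBot → x = cubeBot := by decide

lemma cube_top_le : ∀ z : Cube, cubeTop ≤ z → z = cubeTop := by decide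

lemma cube_mid_between : ∀ x y z : Cube, x ≤ y → y ≤ z →
    ¬(x = cubeBot ∨ x = cubeTop) → ¬(y = cubeBot ∨ y = cubeTop) →
    ¬(z = cubeBot ∨ z = cubeTop) → y = x ∨ y = z := by decide

/-- The representation `M(λ)` of the cube poset. -/
noncomputable def cubeRep (K : Type) [Field K] (lam : K) : PRep K Cube where
  V v := ↥(if v = cubeBot ∨ v = cubeTop then (⊥ : Submodule K K) else ⊤)
  map {x y} h :=
    { toFun := fun v => ⟨cubeCoef lam x y * (v : K), by
        by_cases hy : y = cubeBot ∨ y = cubeTop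
        · simp only [hy, if_true, cubeCoef_zero_right lam x y hy, zero_mul, Submodule.zero_mem]
        · simp [hy]⟩
      map_add' := fun v w => by
        apply Subtype.ext; simp [mul_add]
      map_smul' := fun c v => by
        apply Subtype.ext; simp; ring }
  map_refl x := by
    apply LinearMap.ext; intro v; apply Subtype.ext
    by_cases hx : x = cubeBot ∨ x = cubeTop
    · have hv0 : (v : K) = 0 := by simpa only [hx, if_true, Submodule.mem_bot] using v.2
      show cubeCoef lam x x * (v : K) = (v : K)
      rw [hv0, mul_zero]
    · show cubeCoef lam x x * (v : K) = (v : K)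
      rw [cubeCoef_self lam x hx, one_mul]
  map_trans {x y z} hxy hyz := by
    apply LinearMap.ext; intro v; apply Subtype.ext
    show cubeCoef lam x z * (v : K)
        = cubeCoef lam y z * (cubeCoef lam x y * (v : K))
    by_cases hv : (v : K) = 0
    · simp [hv]
    have hx : ¬(x = cubeBot ∨ x = cubeTop) := fun hx =>
      hv (by simpa only [hx, if_true, Submodule.mem_bot] using v.2)
    by_cases hz : z = cubeBot ∨ z = cubeTop
    · rw [cubeCoef_zero_right lam x z hz, cubeCoef_zero_right lam y z hz]
      ring
    by_cases hy : y = cubeBot ∨ y = cubeTop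
    · exfalso
      rcases hy with hy | hy
      · subst hy
        exact hx (Or.inl (cube_le_bot x hxy))
      · subst hy
        exact hz (Or.inr (cube_top_le z hyz))
    have hkey : y = x ∨ y = z := cube_mid_between x y z hxy hyz hx hy hz
    rcases hkey with h | h
    · subst h
      rw [cubeCoef_self lam y hy]
      ring
    · subst h
      rw [cubeCoef_self lam y hy]
      ring

namespace PRep

/-- If `M` is a direct sum, an invertible structure map of `M` is invertible on each summand. -/
lemma Iso.bijective_map {M N₁ N₂ : PRep K P} (hM : M.Iso (N₁.dsum N₂)) {x y : P} (h : x ≤ y)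
    (hb : Function.Bijective (M.map h)) :
    Function.Bijective (N₁.map h) ∧ Function.Bijective (N₂.map h) := by
  obtain ⟨e, he⟩ := hM
  have hcomp : ⇑((N₁.dsum N₂).map h) ∘ e x = e y ∘ M.map h :=
    funext fun v => LinearMap.congr_fun (he x y h) v
  have hsum : Function.Bijective ((N₁.dsum N₂).map h) := by
    rw [← Function.Bijective.of_comp_iff _ (e x).bijective, hcomp]
    exact (e y).bijective.comp hb
  have hprod : Function.Bijective (Prod.map (N₁.map h) (N₂.map h)) := hsum
  exact (Prod.map_bijective).1 hprod

lemma Iso.subsingleton_iff {M N₁ N₂ : PRep K P} (hM : M.Iso (N₁.dsum N₂)) {x y : P} (h : x ≤ y)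
    (hb : Function.Bijective (M.map h)) :
    (Subsingleton (N₁.V x) ↔ Subsingleton (N₁.V y)) ∧
      (Subsingleton (N₂.V x) ↔ Subsingleton (N₂.V y)) :=
  have hN := hM.bijective_map h hb
  ⟨(Equiv.ofBijective _ hN.1).subsingleton_congr, (Equiv.ofBijective _ hN.2).subsingleton_congr⟩

lemma Iso.finrank_eq {M N₁ N₂ : PRep K P} (hM : M.Iso (N₁.dsum N₂)) (x : P) :
    Module.finrank K (M.V x) = Module.finrank K (N₁.V x) + Module.finrank K (N₂.V x) := by
  obtain ⟨e, -⟩ := hM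
  exact (e x).finrank_eq.trans Module.finrank_prod

lemma Iso.subsingleton_or {M N₁ N₂ : PRep K P} (hM : M.Iso (N₁.dsum N₂)) (hthin : M.IsThin)
    (x : P) : Subsingleton (N₁.V x) ∨ Subsingleton (N₂.V x) := by
  have h₁ := hM.finrank_eq x
  have h₂ := hthin x
  rw [← Module.finrank_zero_iff (R := K), ← Module.finrank_zero_iff (R := K)]
  omega

lemma Iso.subsingleton_and {M N₁ N₂ : PRep K P} (hM : M.Iso (N₁.dsum N₂)) {x : P}
    (hx : Subsingleton (M.V x)) : Subsingleton (N₁.V x) ∧ Subsingleton (N₂.V x) := by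
  have h := hM.finrank_eq x
  rw [Module.finrank_zero_iff.2 hx] at h
  rw [← Module.finrank_zero_iff (R := K), ← Module.finrank_zero_iff (R := K)]
  omega

end PRep

lemma cubeRep_isThin (lam : K) : (cubeRep K lam).IsThin := fun x =>
  (Submodule.finrank_le (if x = cubeBot ∨ x = cubeTop then (⊥ : Submodule K K) else ⊤)).trans
    (Module.finrank_self K).le

lemma cubeRep_subsingleton (lam : K) {x : Cube} (hx : x = cubeBot ∨ x = cubeTop) :
    Subsingleton ((cubeRep K lam).V x) := by
  change Subsingleton ↥(if x = cubeBot ∨ x = cubeTop then (⊥ : Submodule K K) else ⊤)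
  rw [if_pos hx]
  infer_instance

lemma cubeRep_nontrivial (lam : K) {x : Cube} (hx : ¬(x = cubeBot ∨ x = cubeTop)) :
    Nontrivial ((cubeRep K lam).V x) := by
  change Nontrivial ↥(if x = cubeBot ∨ x = cubeTop then (⊥ : Submodule K K) else ⊤)
  rw [if_neg hx]
  exact Submodule.topEquiv.toEquiv.nontrivial

lemma cubeRep_map_bijective (lam : K) {x y : Cube} (h : x ≤ y) (hc : cubeCoef lam x y ≠ 0) :
    Function.Bijective ((cubeRep K lam).map h) := by
  have hx : ¬(x = cubeBot ∨ x = cubeTop) := fun hx => hc (by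
    unfold cubeCoef
    rw [if_pos (by tauto)])
  constructor
  · intro v w hvw
    have hval : cubeCoef lam x y * v.1 = cubeCoef lam x y * w.1 := congrArg Subtype.val hvw
    exact Subtype.ext (mul_left_cancel₀ hc hval)
  · intro w
    refine ⟨⟨(cubeCoef lam x y)⁻¹ * w.1, by simp [hx]⟩, Subtype.ext ?_⟩
    exact mul_inv_cancel_left₀ hc w.1

lemma cubeCoef_eq_one (lam : K) {x y : Cube}
    (h : ¬(x = cubeBot ∨ x = cubeTop ∨ y = cubeBot ∨ y = cubeTop) ∧ ¬(x = cubeA ∧ y = cubeB)) :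
    cubeCoef lam x y = 1 := by
  unfold cubeCoef
  rw [if_neg h.1, if_neg h.2]

/-- The edges of `M(λ)` labelled `1` connect all vertices other than the bottom and the top. -/
lemma cube_forall_of_edges (lam : K) {Q : Cube → Prop} (hbot : Q cubeBot) (htop : Q cubeTop)
    (hedge : ∀ x y : Cube, x ≤ y → cubeCoef lam x y ≠ 0 → (Q x ↔ Q y)) (hA : Q cubeA) :
    ∀ x, Q x := by
  have key : ∀ x y : Cube, x ≤ y →
      ¬(x = cubeBot ∨ x = cubeTop ∨ y = cubeBot ∨ y = cubeTop) ∧ ¬(x = cubeA ∧ y = cubeB) →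
      (Q x ↔ Q y) := fun x y h hxy =>
    hedge x y h (by rw [cubeCoef_eq_one lam hxy]; exact one_ne_zero)
  have h101 : Q (1, 0, 1) := (key cubeA (1, 0, 1) (by decide) (by decide)).1 hA
  have h100 : Q (1, 0, 0) := (key (1, 0, 0) (1, 0, 1) (by decide) (by decide)).2 h101
  have h110 : Q (1, 1, 0) := (key (1, 0, 0) (1, 1, 0) (by decide) (by decide)).1 h100
  have h010 : Q (0, 1, 0) := (key (0, 1, 0) (1, 1, 0) (by decide) (by decide)).2 h110
  have h011 : Q (0, 1, 1) := (key (0, 1, 0) (0, 1, 1) (by decide) (by decide)).1 h010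
  rintro ⟨a, b, c⟩
  fin_cases a <;> fin_cases b <;> fin_cases c <;> assumption

/-- For every `λ ∈ K`, the representation `M(λ)` of the cube
poset is thin and indecomposable. -/
theorem cubeRep_thin_indecomposable (K : Type) [Field K] (lam : K) :
    (cubeRep K lam).IsThin ∧ (cubeRep K lam).Indecomposable := by
  refine ⟨cubeRep_isThin lam, ⟨cubeA, cubeRep_nontrivial lam (by decide)⟩, fun N₁ N₂ hM => ?_⟩
  have hbot := hM.subsingleton_and (cubeRep_subsingleton lam (Or.inl rfl))
  have htop := hM.subsingleton_and (cubeRep_subsingleton lam (Or.inr rfl))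
  have hedge : ∀ x y : Cube, x ≤ y → cubeCoef lam x y ≠ 0 → _ := fun x y h hc =>
    hM.subsingleton_iff h (cubeRep_map_bijective lam h hc)
  exact (hM.subsingleton_or (cubeRep_isThin lam) cubeA).imp
    (cube_forall_of_edges lam hbot.1 htop.1 fun x y h hc => (hedge x y h hc).1)
    (cube_forall_of_edges lam hbot.2 htop.2 fun x y h hc => (hedge x y h hc).2)
end

section
/- Let K be a field, F the fence poset on {0,1,2} whose order is generated by 1 ≤ 0 and 1 ≤ 2, and P = F × F the product poset (a non-equioriented commutative 2D grid). For λ ∈ K, let N(λ) be the representation of P with N(λ)(v) = K for all v ≠ (1,1), N(λ)(1,1) = 0, where the map on the covering relation (1,0) ≤ (2,0) is multiplication by λ and the maps on all other covering relations between nonzero vertices are the identity of K (all other maps zero; this is functorial since every nontrivial commutative square of P passes through (1,1)). Then: (a) for every λ ≠ 1, N(λ) is thin and indecomposable but not isomorphic to the interval representation V_I for any interval I of P; (b) if moreover λ ∉ {0, 1}, then N(λ) is a pre-interval representation not isomorphic to any interval representation. -/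
open Classical

variable {K : Type} [Field K] {P : Type} [PartialOrder P]

/-- The fence poset on `{0,1,2}` whose order is generated by `1 ≤ 0` and
`1 ≤ 2`. -/
def Fence : Type := Fin 3

instance : DecidableEq Fence := inferInstanceAs (DecidableEq (Fin 3))
instance : Fintype Fence := inferInstanceAs (Fintype (Fin 3))

instance : PartialOrder Fence where
  le x y := x = y ∨ x = (1 : Fin 3)
  le_refl x := Or.inl rfl
  le_trans x y z hxy hyz := by
    rcases hxy with h | h
    · rw [h]; exact hyz
    · exact Or.inr h
  le_antisymm x y hxy hyx := by
    rcases hxy with h | h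
    · exact h
    · rcases hyx with h2 | h2
      · exact h2.symm
      · rw [h, h2]

instance : DecidableRel (α := Fence) (· ≤ ·) := fun x y =>
  haveI : Decidable (x = (1 : Fin 3)) := instDecidableEqFence x (1 : Fin 3)
  decidable_of_iff (x = y ∨ x = (1 : Fin 3)) Iff.rfl

def fCenter : Fence × Fence := ((1 : Fin 3), (1 : Fin 3))
def fP1 : Fence × Fence := ((1 : Fin 3), (0 : Fin 3))
def fP2 : Fence × Fence := ((2 : Fin 3), (0 : Fin 3))

/-- Scalar coefficient of the structure map of `N(λ)` from `x` to `y`: zero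
into/out of the zero vertex `(1,1)`, `λ` on the covering relation
`(1,0) ≤ (2,0)`, and `1` otherwise. -/
noncomputable def fenceCoef {K : Type} [Field K] (lam : K)
    (x y : Fence × Fence) : K :=
  if x = fCenter ∨ y = fCenter then 0
  else if x = fP1 ∧ y = fP2 then lam else 1

lemma fenceCoef_self {K : Type} [Field K] (lam : K) (x : Fence × Fence)
    (hx : x ≠ fCenter) : fenceCoef lam x x = 1 := by
  unfold fenceCoef
  rw [if_neg (by tauto), if_neg]
  rintro ⟨h1, h2⟩
  rw [h1] at h2
  exact absurd h2 (by decide)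

lemma fenceCoef_zero_right {K : Type} [Field K] (lam : K)
    (x y : Fence × Fence) (hy : y = fCenter) : fenceCoef lam x y = 0 := by
  unfold fenceCoef
  rw [if_pos (Or.inr hy)]

lemma fence_le_center : ∀ x : Fence × Fence, x ≤ fCenter → x = fCenter := by
  decide

lemma fence_mid_between : ∀ x y z : Fence × Fence, x ≤ y → y ≤ z →
    x ≠ fCenter → y ≠ fCenter → z ≠ fCenter → y = x ∨ y = z := by
  decide

/-- The representation `N(λ)` of the non-equioriented commutative 2D grid
given by the product of two fence posets. -/
noncomputable def fenceRep (K : Type) [Field K] (lam : K) :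
    PRep K (Fence × Fence) where
  V v := ↥(if v = fCenter then (⊥ : Submodule K K) else ⊤)
  map {x y} h :=
    { toFun := fun v => ⟨fenceCoef lam x y * (v : K), by
        by_cases hy : y = fCenter
        · rw [fenceCoef_zero_right lam x y hy]
          simp only [hy, if_true, zero_mul, Submodule.zero_mem]
        · simp [hy]⟩
      map_add' := fun v w => by
        apply Subtype.ext; simp [mul_add]
      map_smul' := fun c v => by
        apply Subtype.ext; simp; ring }
  map_refl x := by
    apply LinearMap.ext; intro v; apply Subtype.ext
    by_cases hx : x = fCenter
    · have hv0 : (v : K) = 0 := by simpa only [hx, if_true, Submodule.mem_bot] using v.2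
      show fenceCoef lam x x * (v : K) = (v : K)
      rw [hv0, mul_zero]
    · show fenceCoef lam x x * (v : K) = (v : K)
      rw [fenceCoef_self lam x hx, one_mul]
  map_trans {x y z} hxy hyz := by
    apply LinearMap.ext; intro v; apply Subtype.ext
    show fenceCoef lam x z * (v : K)
        = fenceCoef lam y z * (fenceCoef lam x y * (v : K))
    by_cases hv : (v : K) = 0
    · simp [hv]
    have hx : x ≠ fCenter := fun hx => hv (by simpa only [hx, if_true, Submodule.mem_bot] using v.2)
    by_cases hz : z = fCenter
    · rw [fenceCoef_zero_right lam x z hz, fenceCoef_zero_right lam y z hz]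
      ring
    by_cases hy : y = fCenter
    · exact absurd (fence_le_center x (hy ▸ hxy)) hx
    rcases fence_mid_between x y z hxy hyz hx hy hz with h | h
    · subst h
      rw [fenceCoef_self lam y hy]
      ring
    · subst h
      rw [fenceCoef_self lam y hy]
      ring

lemma eq_of_fence_path {α : Sort*} (f : Fence × Fence → α)
    (hf : ∀ x y : Fence × Fence, x ≤ y → x ≠ fCenter → y ≠ fCenter →
      ¬ (x = fP1 ∧ y = fP2) → f x = f y)
    {x y : Fence × Fence} (hx : x ≠ fCenter) (hy : y ≠ fCenter) : f x = f y := by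
  let v (i j : Fin 3) : Fence × Fence := (i, j)
  have h₁ : f (v 1 0) = f (v 0 0) :=
    hf _ _ (by decide) (by decide) (by decide) (by decide)
  have h₂ : f (v 0 1) = f (v 0 0) :=
    hf _ _ (by decide) (by decide) (by decide) (by decide)
  have h₃ : f (v 0 1) = f (v 0 2) :=
    hf _ _ (by decide) (by decide) (by decide) (by decide)
  have h₄ : f (v 1 2) = f (v 0 2) :=
    hf _ _ (by decide) (by decide) (by decide) (by decide)
  have h₅ : f (v 1 2) = f (v 2 2) :=
    hf _ _ (by decide) (by decide) (by decide) (by decide)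
  have h₆ : f (v 2 1) = f (v 2 2) :=
    hf _ _ (by decide) (by decide) (by decide) (by decide)
  have h₇ : f (v 2 1) = f (v 2 0) :=
    hf _ _ (by decide) (by decide) (by decide) (by decide)
  have h_list : ∀ z : Fence × Fence, z ≠ fCenter →
      z = v 0 0 ∨ z = v 0 1 ∨ z = v 0 2 ∨ z = v 1 0 ∨ z = v 1 2 ∨
        z = v 2 0 ∨ z = v 2 1 ∨ z = v 2 2 := by decide
  have h_all : ∀ z : Fence × Fence, z ≠ fCenter → f z = f (v 0 0) := by
    intro z hz
    rcases h_list z hz with h | h | h | h | h | h | h | h <;> rw [h] <;> simp_all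
  rw [h_all x hx, h_all y hy]

lemma fenceCoef_eq_one (lam : K) {x y : Fence × Fence} (hx : x ≠ fCenter)
    (hy : y ≠ fCenter) (hxy : ¬ (x = fP1 ∧ y = fP2)) : fenceCoef lam x y = 1 := by
  simp only [fenceCoef, hx, hy, or_self, if_false, hxy]

lemma fenceCoef_P1_P2 (lam : K) : fenceCoef lam fP1 fP2 = lam := by
  have h₁ : fP1 ≠ fCenter := by decide
  have h₂ : fP2 ≠ fCenter := by decide
  simp [fenceCoef, h₁, h₂]

lemma fenceCoef_ne_zero {lam : K} (hlam : lam ≠ 0) {x y : Fence × Fence}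
    (hx : x ≠ fCenter) (hy : y ≠ fCenter) : fenceCoef lam x y ≠ 0 := by
  simp only [fenceCoef, hx, hy, or_self, if_false]
  split_ifs
  exacts [hlam, one_ne_zero]

/-- The generator of `N(λ)` at the vertex `v`, which is zero at the center. -/
noncomputable def fenceGen (lam : K) (v : Fence × Fence) : (fenceRep K lam).V v :=
  (⟨if v = fCenter then 0 else 1, by
    by_cases hv : v = fCenter <;>
      simp only [hv, if_true, if_false, Submodule.zero_mem, Submodule.mem_top]⟩ :
      ↥(if v = fCenter then (⊥ : Submodule K K) else ⊤))

lemma exists_smul_fenceGen (lam : K) (v : Fence × Fence) (m : (fenceRep K lam).V v) :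
    ∃ c : K, m = c • fenceGen lam v := by
  change ↥(if v = fCenter then (⊥ : Submodule K K) else ⊤) at m
  refine ⟨m.1, Subtype.ext ?_⟩
  change m.1 = m.1 * (if v = fCenter then 0 else 1)
  by_cases hv : v = fCenter
  · have := m.2
    simp only [hv, if_true, Submodule.mem_bot] at this
    simp [this]
  · simp [hv]

lemma fenceGen_center (lam : K) : fenceGen lam fCenter = 0 := by
  apply Subtype.ext
  change (if fCenter = fCenter then (0 : K) else 1) = 0
  exact if_pos rfl

lemma fenceGen_ne_zero (lam : K) {v : Fence × Fence} (hv : v ≠ fCenter) :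
    fenceGen lam v ≠ 0 := by
  intro h
  have h' : (if v = fCenter then (0 : K) else 1) = 0 := congrArg Subtype.val h
  simp [hv] at h'

lemma fenceRep_map_gen (lam : K) {x y : Fence × Fence} (h : x ≤ y) :
    (fenceRep K lam).map h (fenceGen lam x) = fenceCoef lam x y • fenceGen lam y := by
  apply Subtype.ext
  change fenceCoef lam x y * (if x = fCenter then 0 else 1) =
    fenceCoef lam x y * (if y = fCenter then 0 else 1)
  by_cases hx : x = fCenter <;> by_cases hy : y = fCenter <;> simp [fenceCoef, hx, hy]

lemma mem_supp_fenceRep (lam : K) (v : Fence × Fence) :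
    v ∈ (fenceRep K lam).supp ↔ v ≠ fCenter := by
  constructor
  · rintro h rfl
    obtain ⟨m, hm⟩ := @exists_ne _ h (0 : (fenceRep K lam).V fCenter)
    obtain ⟨c, rfl⟩ := exists_smul_fenceGen lam _ m
    exact hm (by rw [fenceGen_center, smul_zero])
  · exact fun hv => ⟨⟨_, _, fenceGen_ne_zero lam hv⟩⟩

lemma fenceRep_isThin (lam : K) : (fenceRep K lam).IsThin := by
  intro v
  exact (Submodule.finrank_le _).trans_eq (Module.finrank_self K)

lemma isIntervalSet_ne_fCenter : IsIntervalSet {v : Fence × Fence | v ≠ fCenter} := by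
  refine ⟨⟨fP1, by decide⟩, ?_, ?_⟩
  · rintro a b c ha - hab - rfl
    exact ha (fence_le_center a hab)
  · intro a ha b hb
    refine (eq_of_fence_path (fun z => Relation.ReflTransGen _ a z) ?_ ha hb).mp .refl
    intro x y hxy hx hy _
    exact propext ⟨fun h => h.tail ⟨hx, hy, .inl hxy⟩, fun h => h.tail ⟨hy, hx, .inr hxy⟩⟩

lemma fenceRep_isPreInterval {lam : K} (hlam : lam ≠ 0) :
    (fenceRep K lam).IsPreInterval := by
  refine ⟨fenceRep_isThin lam, ?_, ?_⟩
  · rw [show (fenceRep K lam).supp = {v | v ≠ fCenter} from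
      Set.ext (mem_supp_fenceRep lam)]
    exact isIntervalSet_ne_fCenter
  · intro x y h hx hy h_zero
    rw [mem_supp_fenceRep] at hx hy
    have h_gen := fenceRep_map_gen lam h
    rw [h_zero, LinearMap.zero_apply] at h_gen
    exact smul_ne_zero (fenceCoef_ne_zero hlam hx hy) (fenceGen_ne_zero lam hy) h_gen.symm

lemma fenceRep_indecomposable (lam : K) : (fenceRep K lam).Indecomposable := by
  refine ⟨⟨fP1, (mem_supp_fenceRep lam fP1).mpr (by decide)⟩, ?_⟩
  rintro N₁ N₂ ⟨e, he⟩
  let g (v : Fence × Fence) : N₁.V v × N₂.V v := e v (fenceGen lam v)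
  have hg_span (v) (w : N₁.V v × N₂.V v) : ∃ c : K, w = c • g v := by
    obtain ⟨c, hc⟩ := exists_smul_fenceGen lam v ((e v).symm w)
    exact ⟨c, by rw [← (e v).apply_symm_apply w, hc, map_smul]; rfl⟩
  have hg_ne (v) (hv : v ≠ fCenter) : g v ≠ 0 :=
    fun h => fenceGen_ne_zero lam hv ((e v).map_eq_zero_iff.mp h)
  have hg_or (v) : (g v).1 = 0 ∨ (g v).2 = 0 := by
    obtain ⟨c, hc⟩ := hg_span v ((g v).1, 0)
    have hc₁ : (g v).1 = c • (g v).1 := congrArg Prod.fst hc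
    have hc₂ : 0 = c • (g v).2 := congrArg Prod.snd hc
    rcases smul_eq_zero.mp hc₂.symm with h | h
    · left; rw [hc₁, h, zero_smul]
    · exact .inr h
  have hg_map {x y} (h : x ≤ y) :
      (N₁.map h (g x).1, N₂.map h (g x).2) = fenceCoef lam x y • g y := by
    have := LinearMap.congr_fun (he x y h) (fenceGen lam x)
    rw [LinearMap.comp_apply, LinearMap.comp_apply, fenceRep_map_gen, map_smul] at this
    exact this
  have h_const {x y} (hx : x ≠ fCenter) (hy : y ≠ fCenter) :
      ((g x).1 = 0) = ((g y).1 = 0) := by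
    refine eq_of_fence_path (fun v => (g v).1 = 0) (fun x y h hx hy hxy => propext ?_) hx hy
    have h_map := hg_map h
    rw [fenceCoef_eq_one lam hx hy hxy, one_smul] at h_map
    have h₁ : N₁.map h (g x).1 = (g y).1 := congrArg Prod.fst h_map
    have h₂ : N₂.map h (g x).2 = (g y).2 := congrArg Prod.snd h_map
    refine ⟨fun h0 => by rw [← h₁, h0, map_zero], fun h0 => (hg_or x).resolve_right ?_⟩
    intro h0'
    exact hg_ne y hy (Prod.ext h0 (by rw [← h₂, h0', map_zero]; rfl))
  have hP1 : fP1 ≠ fCenter := by decide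
  have hg_center : g fCenter = 0 := by
    change e fCenter (fenceGen lam fCenter) = 0
    rw [fenceGen_center, map_zero]
  by_cases h0 : (g fP1).1 = 0
  · left
    intro v
    have hv : (g v).1 = 0 := by
      by_cases hc : v = fCenter
      · subst hc; rw [hg_center]; rfl
      · exact (h_const hP1 hc).mp h0
    refine subsingleton_of_forall_eq 0 fun a => ?_
    obtain ⟨c, hc⟩ := hg_span v (a, 0)
    rw [show a = c • (g v).1 from congrArg Prod.fst hc, hv, smul_zero]
  · right
    intro v
    have hv : (g v).2 = 0 := by
      by_cases hc : v = fCenter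
      · subst hc; rw [hg_center]; rfl
      · exact (hg_or v).resolve_left fun h => h0 ((h_const hP1 hc).mpr h)
    refine subsingleton_of_forall_eq 0 fun b => ?_
    obtain ⟨c, hc⟩ := hg_span v (0, b)
    rw [show b = c • (g v).2 from congrArg Prod.snd hc, hv, smul_zero]

lemma not_iso_intervalRep_fenceRep {lam : K} (hlam : lam ≠ 1)
    (I : Set (Fence × Fence)) (hI : IsConvexSet I) :
    ¬ (fenceRep K lam).Iso (intervalRep K I hI) := by
  rintro ⟨e, he⟩
  let g (v : Fence × Fence) : ↥(if v ∈ I then (⊤ : Submodule K K) else ⊥) :=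
    e v (fenceGen lam v)
  have hg_ne {v} (hv : v ≠ fCenter) : (g v : K) ≠ 0 := fun h =>
    fenceGen_ne_zero lam hv ((e v).map_eq_zero_iff.mp (Subtype.ext h))
  have h_mem {v} (hv : v ≠ fCenter) : v ∈ I := by
    by_contra hvI
    refine hg_ne hv ?_
    simpa only [hvI, if_false, Submodule.mem_bot] using (g v).2
  have hg_map {x y} (h : x ≤ y) (hy : y ≠ fCenter) :
      (g x : K) = fenceCoef lam x y * (g y : K) := by
    have h_comm := LinearMap.congr_fun (he x y h) (fenceGen lam x)
    rw [LinearMap.comp_apply, LinearMap.comp_apply, fenceRep_map_gen, map_smul] at h_comm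
    have h_val : (if y ∈ I then (g x : K) else 0) = fenceCoef lam x y * (g y : K) :=
      congrArg Subtype.val h_comm
    rwa [if_pos (h_mem hy)] at h_val
  have hP1 : fP1 ≠ fCenter := by decide
  have hP2 : fP2 ≠ fCenter := by decide
  have h_eq : (g fP1 : K) = (g fP2 : K) := by
    refine eq_of_fence_path (fun v => (g v : K)) (fun x y h hx hy hxy => ?_) hP1 hP2
    simpa only [fenceCoef_eq_one lam hx hy hxy, one_mul] using hg_map h hy
  have h_lam := hg_map (show fP1 ≤ fP2 by decide) hP2
  rw [fenceCoef_P1_P2, h_eq] at h_lam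
  exact hlam (mul_right_cancel₀ (hg_ne hP2) (by rw [← h_lam, one_mul]))

/-- (a) For `λ ≠ 1`, the representation `N(λ)` of the product of
two fences is thin and indecomposable but not isomorphic to any interval
representation; (b) for `λ ∉ {0,1}`, it is moreover a pre-interval
representation not isomorphic to any interval representation. -/
theorem fenceRep_example (K : Type) [Field K] (lam : K) :
    (lam ≠ 1 →
      (fenceRep K lam).IsThin ∧ (fenceRep K lam).Indecomposable ∧
        ¬ ∃ (I : Set (Fence × Fence)) (hI : IsIntervalSet I),
          (fenceRep K lam).Iso (intervalRep K I hI.2.1)) ∧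
    (lam ≠ 0 → lam ≠ 1 →
      (fenceRep K lam).IsPreInterval ∧
        ¬ ∃ (I : Set (Fence × Fence)) (hI : IsIntervalSet I),
          (fenceRep K lam).Iso (intervalRep K I hI.2.1)) := by
  have h_not (h : lam ≠ 1) : ¬ ∃ (I : Set (Fence × Fence)) (hI : IsIntervalSet I),
      (fenceRep K lam).Iso (intervalRep K I hI.2.1) :=
    fun ⟨I, hI, h_iso⟩ => not_iso_intervalRep_fenceRep h I hI.2.1 h_iso
  exact ⟨fun h => ⟨fenceRep_isThin lam, fenceRep_indecomposable lam, h_not h⟩,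
    fun h_zero h_one => ⟨fenceRep_isPreInterval h_zero, h_not h_one⟩⟩
end
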